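/- arXiv:1901.04887 — 2 statements merged into one kernel-verified Lean document; each statement's English description precedes it below -/
import Mathlib

section
/- If X is a compactum and κ is an infinite cardinal, then L(X_κ) ≤ 2^{wt(X)·κ}, where X_κ denotes the set X retopologized by taking the G_κ-subsets of X as a base. -/
open Cardinal Set Topology
universe u
noncomputable section

/-- The tightness of a space: the least infinite cardinal `τ` such that whenever
`y ∈ closure A` there is `B ⊆ A` with `#B ≤ τ` and `y ∈ closure B`. -/
def tightness (Y : Type u) [TopologicalSpace Y] : Cardinal.{u} :=
  sInf {τ : Cardinal.{u} | ℵ₀ ≤ τ ∧ ∀ (A : Set Y) (y : Y), y ∈ closure A →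
    ∃ B ⊆ A, #B ≤ τ ∧ y ∈ closure B}

/-- The `μ`-closure of a set `A`: the union of the closures of all subsets of `A`
of cardinality at most `μ`. -/
def kClosure {X : Type u} [TopologicalSpace X] (μ : Cardinal.{u}) (A : Set X) : Set X :=
  ⋃ B ∈ {B : Set X | B ⊆ A ∧ #B ≤ μ}, closure B

/-- `𝒞` witnesses that the weak tightness of `X` is at most `κ`. -/
def IsWeakTightnessWitness (X : Type u) [TopologicalSpace X] (κ : Cardinal.{u})
    (𝒞 : Set (Set X)) : Prop :=
  ⋃₀ 𝒞 = Set.univ ∧ #𝒞 ≤ 2 ^ κ ∧ ∀ C ∈ 𝒞, tightness C ≤ κ ∧ kClosure (2 ^ κ) C = Set.univ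

/-- The weak tightness of `X`: the least infinite cardinal `κ` for which there is a
cover `𝒞` of `X` with `#𝒞 ≤ 2^κ` such that each `C ∈ 𝒞` has tightness at most `κ`
and `X = cl_{2^κ} C`. -/
def weakTightness (X : Type u) [TopologicalSpace X] : Cardinal.{u} :=
  sInf {κ : Cardinal.{u} | ℵ₀ ≤ κ ∧ ∃ 𝒞 : Set (Set X), IsWeakTightnessWitness X κ 𝒞}

/-- The π-character of a point `x`: the least cardinality of a family of nonempty
open sets such that every neighborhood of `x` contains a member of the family. -/
def piCharacterAt {X : Type u} [TopologicalSpace X] (x : X) : Cardinal.{u} :=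
  sInf {c : Cardinal.{u} | ∃ 𝒰 : Set (Set X), #𝒰 = c ∧
    (∀ U ∈ 𝒰, IsOpen U ∧ U.Nonempty) ∧ ∀ N ∈ nhds x, ∃ U ∈ 𝒰, U ⊆ N}

/-- The π-character of a space: the supremum of the π-characters at its points
(at least `ℵ₀`). -/
def piCharacter (X : Type u) [TopologicalSpace X] : Cardinal.{u} :=
  max ℵ₀ (⨆ x : X, piCharacterAt x)

/-- The Lindelöf degree: the least infinite cardinal `κ` such that every open cover
has a subcover of cardinality at most `κ`. -/
def lindelofDegree (X : Type u) [TopologicalSpace X] : Cardinal.{u} :=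
  sInf {κ : Cardinal.{u} | ℵ₀ ≤ κ ∧ ∀ 𝒰 : Set (Set X), (∀ U ∈ 𝒰, IsOpen U) →
    ⋃₀ 𝒰 = Set.univ → ∃ 𝒱 ⊆ 𝒰, #𝒱 ≤ κ ∧ ⋃₀ 𝒱 = Set.univ}

/-- The density of `X`: the least infinite cardinality of a dense subset. -/
def density (X : Type u) [TopologicalSpace X] : Cardinal.{u} :=
  sInf {c : Cardinal.{u} | ℵ₀ ≤ c ∧ ∃ D : Set X, Dense D ∧ #D ≤ c}

/-- The pseudocharacter of a subset `F` of `X`: the least infinite cardinality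
of a family of open sets whose intersection is `F`. -/
def setPseudoCharacter {X : Type u} [TopologicalSpace X] (F : Set X) : Cardinal.{u} :=
  sInf {κ : Cardinal.{u} | ℵ₀ ≤ κ ∧ ∃ 𝒰 : Set (Set X), #𝒰 ≤ κ ∧
    (∀ U ∈ 𝒰, IsOpen U) ∧ ⋂₀ 𝒰 = F}

/-- The pseudocharacter of a space: the least infinite `κ` such that every singleton
is the intersection of at most `κ` open sets. -/
def pseudoCharacter (X : Type u) [TopologicalSpace X] : Cardinal.{u} :=
  sInf {κ : Cardinal.{u} | ℵ₀ ≤ κ ∧ ∀ x : X, ∃ 𝒰 : Set (Set X), #𝒰 ≤ κ ∧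
    (∀ U ∈ 𝒰, IsOpen U) ∧ ⋂₀ 𝒰 = {x}}

/-- The character of a (closed) set `G` in `X`: the least infinite cardinality of a
family `𝒰` of open sets containing `G` such that every open set containing `G`
contains a member of `𝒰`. -/
def setCharacter {X : Type u} [TopologicalSpace X] (G : Set X) : Cardinal.{u} :=
  sInf {κ : Cardinal.{u} | ℵ₀ ≤ κ ∧ ∃ 𝒰 : Set (Set X), #𝒰 ≤ κ ∧
    (∀ U ∈ 𝒰, IsOpen U ∧ G ⊆ U) ∧ ∀ V : Set X, IsOpen V → G ⊆ V → ∃ U ∈ 𝒰, U ⊆ V}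

/-- A cardinal `λ` is a caliber of `X` if every `λ`-indexed family of nonempty open
sets has a subfamily of cardinality `λ` with nonempty intersection. -/
def IsCaliber (X : Type u) [TopologicalSpace X] (lam : Cardinal.{u}) : Prop :=
  ∀ (ι : Type u) (U : ι → Set X), #ι = lam → (∀ i, IsOpen (U i) ∧ (U i).Nonempty) →
    ∃ J : Set ι, #J = lam ∧ (⋂ i ∈ J, U i).Nonempty

/-- A space is quasiregular if every nonempty open set contains the closure of a
nonempty open set. -/
def Quasiregular (X : Type u) [TopologicalSpace X] : Prop :=
  ∀ U : Set X, IsOpen U → U.Nonempty → ∃ V : Set X, IsOpen V ∧ V.Nonempty ∧ closure V ⊆ U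

/-- The θ-closure of a set `A`. -/
def thetaClosure {X : Type u} [TopologicalSpace X] (A : Set X) : Set X :=
  {x : X | ∀ U : Set X, IsOpen U → x ∈ U → (closure U ∩ A).Nonempty}

/-- The θ-density of `X`: the least infinite cardinality of a θ-dense subset. -/
def thetaDensity (X : Type u) [TopologicalSpace X] : Cardinal.{u} :=
  sInf {c : Cardinal.{u} | ℵ₀ ≤ c ∧ ∃ D : Set X, thetaClosure D = Set.univ ∧ #D ≤ c}

/-- The linear Lindelöf degree: the least infinite cardinal `κ` such that every open
cover totally ordered by inclusion has a subcover of cardinality at most `κ`. -/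
def linearLindelofDegree (X : Type u) [TopologicalSpace X] : Cardinal.{u} :=
  sInf {κ : Cardinal.{u} | ℵ₀ ≤ κ ∧ ∀ 𝒰 : Set (Set X), (∀ U ∈ 𝒰, IsOpen U) →
    IsChain (· ⊆ ·) 𝒰 → ⋃₀ 𝒰 = Set.univ → ∃ 𝒱 ⊆ 𝒰, #𝒱 ≤ κ ∧ ⋃₀ 𝒱 = Set.univ}

/-- The almost Lindelöf degree with respect to closed sets. -/
def almostLindelofDegreeClosed (X : Type u) [TopologicalSpace X] : Cardinal.{u} :=
  sInf {κ : Cardinal.{u} | ℵ₀ ≤ κ ∧ ∀ (F : Set X) (𝒱 : Set (Set X)), IsClosed F →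
    (∀ V ∈ 𝒱, IsOpen V) → F ⊆ ⋃₀ 𝒱 →
    ∃ 𝒱' ⊆ 𝒱, #𝒱' ≤ κ ∧ F ⊆ ⋃ V ∈ 𝒱', closure V}

/-- The closed pseudocharacter of a space. -/
def closedPseudoCharacter (X : Type u) [TopologicalSpace X] : Cardinal.{u} :=
  sInf {κ : Cardinal.{u} | ℵ₀ ≤ κ ∧ ∀ x : X, ∃ 𝒰 : Set (Set X), #𝒰 ≤ κ ∧
    (∀ U ∈ 𝒰, IsOpen U ∧ x ∈ U) ∧ ⋂ U ∈ 𝒰, closure U = {x}}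

/-- Every family of at most `2 ^ #ι` many `ι`-ary operations (packaged as one set-valued
operation) admits a closed set of cardinality at most `2 ^ #ι` above any given such set. -/
theorem exists_superset_closed_under {X ι : Type u} [Infinite ι] (A₀ : Set X)
    (hA₀ : #A₀ ≤ 2 ^ #ι) (Φ : (ι → X) → Set X) (hΦ : ∀ g, #(Φ g) ≤ 2 ^ #ι) :
    ∃ A : Set X, A₀ ⊆ A ∧ #A ≤ 2 ^ #ι ∧ ∀ g : ι → X, (∀ i, g i ∈ A) → Φ g ⊆ A := by
  have hι : ℵ₀ ≤ #ι := aleph0_le_mk ι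
  have h2 : ℵ₀ ≤ (2 : Cardinal.{u}) ^ #ι := hι.trans (cantor _).le
  have hpow : ((2 : Cardinal.{u}) ^ #ι) ^ #ι = 2 ^ #ι := by
    rw [← power_mul, mul_eq_self hι]
  let T : Type u := (Order.succ #ι).ord.ToType
  let step : (α : T) → ((β : T) → β < α → Set X) → Set X := fun α S =>
    A₀ ∪ ⋃ g : ι → (⋃ β : {β : T // β < α}, S β β.2 : Set X), Φ fun i => (g i : X)
  let F : T → Set X := wellFounded_lt.fix step
  have hF : ∀ α, F α = A₀ ∪ ⋃ g : ι → (⋃ β : {β : T // β < α}, F β : Set X),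
      Φ fun i => (g i : X) := fun α => wellFounded_lt.fix_eq step α
  have hlt : ∀ α : T, #{β : T // β < α} ≤ #ι := fun α =>
    Order.lt_succ_iff.1 ((mk_Iio_lt α (by simp [T])).trans_eq (mk_ord_toType _))
  have hcard : ∀ α, #(F α) ≤ 2 ^ #ι := by
    intro α
    induction α using WellFoundedLT.induction with
    | _ α ih =>
      have hU : #(⋃ β : {β : T // β < α}, F β : Set X) ≤ 2 ^ #ι := by
        refine (mk_iUnion_le _).trans ?_
        refine (mul_le_mul' ((hlt α).trans (cantor _).le)
          (ciSup_le' fun β : {β : T // β < α} => ih β.1 β.2)).trans ?_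
        exact (mul_eq_self h2).le
      rw [hF]
      refine (mk_union_le _ _).trans (add_le_of_le h2 hA₀ ((mk_iUnion_le _).trans ?_))
      refine (mul_le_mul' ?_ (ciSup_le' fun g => hΦ _)).trans (mul_eq_self h2).le
      rw [← power_def]
      exact (power_le_power_right hU).trans hpow.le
  refine ⟨⋃ α, F α, ?_, ?_, ?_⟩
  · have : Nonempty T := by
      rw [← mk_ne_zero_iff]
      simp [T]
    intro x hx
    exact mem_iUnion.2 ⟨Classical.arbitrary T, by rw [hF]; exact Or.inl hx⟩
  · refine (mk_iUnion_le _).trans ?_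
    refine (mul_le_mul' ?_ (ciSup_le' hcard)).trans (mul_eq_self h2).le
    simpa [T] using Order.succ_le_of_lt (cantor #ι)
  · intro g hg
    choose a ha using fun i => mem_iUnion.1 (hg i)
    obtain ⟨α, hα⟩ : ∃ α : T, ∀ i, a i < α := by
      by_contra! hcon
      have hcof : IsCofinal (range a) := fun α =>
        let ⟨i, hi⟩ := hcon α
        ⟨a i, mem_range_self i, hi⟩
      have h1 := Order.cof_le hcof
      rw [Ordinal.cof_toType, (isRegular_succ hι).cof_ord] at h1
      exact (h1.trans mk_range_le).not_gt (Order.lt_succ _)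
    intro x hx
    refine mem_iUnion.2 ⟨α, ?_⟩
    rw [hF]
    exact Or.inr (mem_iUnion.2 ⟨fun i => ⟨g i, mem_iUnion.2 ⟨⟨a i, hα i⟩, ha i⟩⟩, hx⟩)

theorem exists_subset_of_tightness_le {Y : Type u} [TopologicalSpace Y] {κ : Cardinal.{u}}
    (h : tightness Y ≤ κ) {A : Set Y} {y : Y} (hy : y ∈ closure A) :
    ∃ B ⊆ A, #B ≤ κ ∧ y ∈ closure B := by
  have hne : {τ : Cardinal.{u} | ℵ₀ ≤ τ ∧ ∀ (A : Set Y) (y : Y), y ∈ closure A →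
      ∃ B ⊆ A, #B ≤ τ ∧ y ∈ closure B}.Nonempty :=
    ⟨max ℵ₀ #Y, le_max_left _ _, fun A y hy =>
      ⟨A, Subset.rfl, (mk_set_le A).trans (le_max_right _ _), hy⟩⟩
  obtain ⟨B, hBA, hB, hyB⟩ := (csInf_mem hne).2 A y hy
  exact ⟨B, hBA, hB.trans h, hyB⟩

theorem exists_isWeakTightnessWitness (X : Type u) [TopologicalSpace X] :
    ℵ₀ ≤ weakTightness X ∧ ∃ 𝒞 : Set (Set X), IsWeakTightnessWitness X (weakTightness X) 𝒞 := by
  refine csInf_mem (s := {κ : Cardinal.{u} | ℵ₀ ≤ κ ∧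
    ∃ 𝒞 : Set (Set X), IsWeakTightnessWitness X κ 𝒞})
    ⟨max ℵ₀ #X, le_max_left _ _, {Set.univ}, ?_, ?_, ?_⟩
  · simp
  · rw [mk_singleton]
    exact one_le_two.trans
      (self_le_power 2 (one_le_aleph0.trans (le_max_left _ _)))
  · rintro C rfl
    refine ⟨csInf_le' ⟨le_max_left _ _, fun A y hy =>
      ⟨A, Subset.rfl, (mk_set_le A).trans (by simp), hy⟩⟩, ?_⟩
    refine eq_univ_of_forall fun x => mem_biUnion (x := Set.univ) ⟨Subset.rfl, ?_⟩ (by simp)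
    rw [mk_univ]
    exact (le_max_right _ _).trans (cantor _).le

theorem IsWeakTightnessWitness.mono {X : Type u} [TopologicalSpace X] {κ μ : Cardinal.{u}}
    {𝒞 : Set (Set X)} (h : IsWeakTightnessWitness X κ 𝒞) (hκμ : κ ≤ μ) :
    IsWeakTightnessWitness X μ 𝒞 := by
  have hpow : (2 : Cardinal.{u}) ^ κ ≤ 2 ^ μ := power_le_power_left two_ne_zero hκμ
  refine ⟨h.1, h.2.1.trans hpow, fun C hC => ⟨(h.2.2 C hC).1.trans hκμ, ?_⟩⟩
  refine eq_univ_of_univ_subset ((h.2.2 C hC).2 ▸ ?_)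
  exact biUnion_subset_biUnion_left fun B hB => ⟨hB.1, hB.2.trans hpow⟩

/-- A nonempty set of cardinality at most `#ι` is the range of a function on `ι`. -/
theorem exists_range_eq_of_mk_le {α ι : Type u} {s : Set α} (hs : s.Nonempty) (h : #s ≤ #ι) :
    ∃ f : ι → α, range f = s := by
  obtain ⟨e⟩ := h
  have : Nonempty s := hs.to_subtype
  have hsurj : Function.Surjective (Function.invFun e) := Function.invFun_surjective e.injective
  exact ⟨Subtype.val ∘ Function.invFun e, by rw [hsurj.range_comp, Subtype.range_coe]⟩

/-- The `G_κ`-sets form a base of the topology they generate. -/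
theorem exists_Gκ_subset {X : Type u} [TopologicalSpace X] {κ : Cardinal.{u}} (hκ : ℵ₀ ≤ κ)
    {W : Set X} (hW : IsOpen[TopologicalSpace.generateFrom
      {G : Set X | ∃ 𝒰 : Set (Set X), #𝒰 ≤ κ ∧ (∀ U ∈ 𝒰, IsOpen U) ∧ G = ⋂₀ 𝒰}] W)
    {x : X} (hx : x ∈ W) :
    ∃ 𝒰 : Set (Set X), #𝒰 ≤ κ ∧ (∀ U ∈ 𝒰, IsOpen U) ∧ x ∈ ⋂₀ 𝒰 ∧ ⋂₀ 𝒰 ⊆ W := by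
  induction hW with
  | basic G hG =>
    obtain ⟨𝒰, h1, h2, rfl⟩ := hG
    exact ⟨𝒰, h1, h2, hx, Subset.rfl⟩
  | univ => exact ⟨∅, by simp, by simp, by simp, by simp⟩
  | inter S T _ _ ihS ihT =>
    obtain ⟨𝒰, h1, h2, h3, h4⟩ := ihS hx.1
    obtain ⟨𝒱, h1', h2', h3', h4'⟩ := ihT hx.2
    refine ⟨𝒰 ∪ 𝒱, (mk_union_le _ _).trans (add_le_of_le hκ h1 h1'), ?_, ?_, ?_⟩
    · rintro U (hU | hU)
      exacts [h2 U hU, h2' U hU]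
    · rw [sInter_union]
      exact ⟨h3, h3'⟩
    · rw [sInter_union]
      exact inter_subset_inter h4 h4'
  | sUnion 𝒮 _ ih =>
    obtain ⟨S, hS, hxS⟩ := hx
    obtain ⟨𝒰, h1, h2, h3, h4⟩ := ih S hS hxS
    exact ⟨𝒰, h1, h2, h3, h4.trans (subset_sUnion_of_mem hS)⟩

/-- In a regular space, a `G_κ`-set around a point `y` of the closure of a set `B` of cardinality
at most `κ` contains a set around `y` that is an intersection of at most `κ` closures of
subsets of `B`. -/
theorem exists_iInter_closure_range_subset {X ι : Type u} [TopologicalSpace X] [RegularSpace X]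
    {B : Set X} (hB : #B ≤ #ι) {y : X} (hy : y ∈ closure B) (h : ι → Set X)
    (ho : ∀ i, IsOpen (h i)) (hyh : ∀ i, y ∈ h i) :
    ∃ f : ι → ι → X, (∀ i j, f i j ∈ B) ∧ (∀ i, y ∈ closure (range (f i))) ∧
      ∀ i, closure (range (f i)) ⊆ h i := by
  have key : ∀ i, ∃ f : ι → X, (∀ j, f j ∈ B) ∧ y ∈ closure (range f) ∧
      closure (range f) ⊆ h i := by
    intro i
    obtain ⟨V, hV, hVc, hVh⟩ := exists_mem_nhds_isClosed_subset ((ho i).mem_nhds (hyh i))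
    have hyV : y ∈ closure (B ∩ V) := by
      rw [mem_closure_iff_nhds] at hy ⊢
      intro N hN
      obtain ⟨z, hz, hzB⟩ := hy (N ∩ V) (Filter.inter_mem hN hV)
      exact ⟨z, hz.1, hzB, hz.2⟩
    obtain ⟨f, hf⟩ := exists_range_eq_of_mk_le (closure_nonempty_iff.1 ⟨y, hyV⟩)
      ((mk_le_mk_of_subset inter_subset_left).trans hB)
    refine ⟨f, fun j => (hf ▸ mem_range_self j : f j ∈ B ∩ V).1, hf ▸ hyV, ?_⟩
    rw [hf]
    exact (closure_minimal inter_subset_right hVc).trans hVh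
  choose f hf using key
  exact ⟨f, fun i => (hf i).1, fun i => (hf i).2.1, fun i => (hf i).2.2⟩

/-- A saturated set is `κ`-dense in its closure: if `A ∩ C` is dense in `A` for every
member `C` of a witness, then each point of `closure A` is in the closure of
a subset of `A` of cardinality at most `κ`. -/
theorem IsWeakTightnessWitness.exists_subset_of_mem_closure {X : Type u} [TopologicalSpace X]
    {κ : Cardinal.{u}} {𝒞 : Set (Set X)} (h : IsWeakTightnessWitness X κ 𝒞) {A : Set X}
    (hA : ∀ C ∈ 𝒞, A ⊆ closure (A ∩ C)) {y : X} (hy : y ∈ closure A) :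
    ∃ B ⊆ A, #B ≤ κ ∧ y ∈ closure B := by
  obtain ⟨C, hC, hyC⟩ : y ∈ ⋃₀ 𝒞 := h.1 ▸ mem_univ y
  have hy' : (⟨y, hyC⟩ : C) ∈ closure ((↑) ⁻¹' A : Set C) := by
    rw [closure_subtype, Subtype.image_preimage_coe, inter_comm]
    exact closure_minimal (hA C hC) isClosed_closure hy
  obtain ⟨B, hBA, hB, hyB⟩ := exists_subset_of_tightness_le (h.2.2 C hC).1 hy'
  refine ⟨(↑) '' B, image_subset_iff.2 hBA, mk_image_le.trans hB, ?_⟩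
  exact closure_subtype.1 hyB

/-- Every cover of a compactum that is refined by a cover by `G_κ`-sets has a subcover of
cardinality at most `2 ^ κ`, if the weak tightness is at most `κ = #ι`. -/
theorem IsWeakTightnessWitness.exists_subcover {X ι : Type u} [TopologicalSpace X] [CompactSpace X]
    [RegularSpace X] [Infinite ι] {𝒞 : Set (Set X)} (h𝒞 : IsWeakTightnessWitness X #ι 𝒞)
    (𝒰 : Set (Set X))
    (h𝒰 : ∀ x, ∃ W ∈ 𝒰, ∃ h : ι → Set X, (∀ i, IsOpen (h i)) ∧ (∀ i, x ∈ h i) ∧ ⋂ i, h i ⊆ W) :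
    ∃ 𝒱 ⊆ 𝒰, #𝒱 ≤ 2 ^ #ι ∧ ⋃₀ 𝒱 = Set.univ := by
  classical
  have hι : ℵ₀ ≤ #ι := aleph0_le_mk ι
  have h2 : ℵ₀ ≤ (2 : Cardinal.{u}) ^ #ι := hι.trans (cantor _).le
  rcases isEmpty_or_nonempty X with hX | ⟨⟨x₀⟩⟩
  · exact ⟨∅, empty_subset _, by simp, Subsingleton.elim _ _⟩
  let P : (ι → ι → X) → Set X → (ι → Set X) → Prop := fun f W h =>
    W ∈ 𝒰 ∧ (∀ i, IsOpen (h i)) ∧ (∀ i, closure (range (f i)) ⊆ h i) ∧ ⋂ i, h i ⊆ W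
  have hchoice : ∀ f, ∃ W h, (∃ W h, P f W h) → P f W h := fun f => by
    by_cases hf : ∃ W h, P f W h
    · obtain ⟨W, h, hWh⟩ := hf
      exact ⟨W, h, fun _ => hWh⟩
    · exact ⟨∅, fun _ => ∅, fun hf' => absurd hf' hf⟩
  choose W h hP using hchoice
  have hsat : ∀ (x : X) (C : 𝒞), ∃ B : Set X, B ⊆ C ∧ #B ≤ 2 ^ #ι ∧ x ∈ closure B := by
    intro x C
    have hx : x ∈ kClosure (2 ^ #ι) (C : Set X) := (h𝒞.2.2 C C.2).2 ▸ mem_univ x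
    obtain ⟨B, hB, hxB⟩ := mem_iUnion₂.1 hx
    exact ⟨B, hB.1, hB.2, hxB⟩
  choose D hDC hD hxD using hsat
  let i₀ : ι := Classical.arbitrary ι
  let p : Set X → X := fun S => if hS : Sᶜ.Nonempty then hS.some else x₀
  have hp : ∀ S : Set X, ∀ x ∉ S, p S ∉ S := fun S x hx => by
    have hS : Sᶜ.Nonempty := ⟨x, hx⟩
    simp only [p, dif_pos hS]
    exact hS.some_mem
  let Φ : (ι × ι × ι → X) → Set X := fun g =>
    (⋃ C : 𝒞, D (g (i₀, i₀, i₀)) C) ∪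
      range fun j : ι → ι => p (⋃ k, h (fun i l => g (k, i, l)) (j k))
  have hι3 : #(ι × ι × ι) = #ι := by simp [mul_eq_self hι]
  obtain ⟨A, hA₀, hA, hAΦ⟩ := exists_superset_closed_under (ι := ι × ι × ι) {x₀}
    (by rw [mk_singleton]; exact one_le_aleph0.trans (hι3 ▸ h2)) Φ (by
      intro g
      rw [hι3]
      refine (mk_union_le _ _).trans (add_le_of_le h2 ?_ ?_)
      · exact (mk_iUnion_le _).trans
          ((mul_le_mul' h𝒞.2.1 (ciSup_le' fun C => hD _ C)).trans (mul_eq_self h2).le)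
      · refine mk_range_le.trans ?_
        rw [← power_def, power_self_eq hι])
  rw [hι3] at hA
  have hAsat : ∀ C ∈ 𝒞, A ⊆ closure (A ∩ C) := by
    intro C hC a ha
    refine closure_mono (subset_inter ?_ (hDC a ⟨C, hC⟩)) (hxD a ⟨C, hC⟩)
    exact fun z hz => hAΦ (fun _ => a) (fun _ => ha) (Or.inl (mem_iUnion.2 ⟨⟨C, hC⟩, hz⟩))
  have hcover : ∀ y ∈ closure A, ∃ f : ι → ι → X, (∀ i l, f i l ∈ A) ∧
      P f (W f) (h f) ∧ ∀ i, y ∈ h f i := by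
    intro y hy
    obtain ⟨B, hBA, hB, hyB⟩ := h𝒞.exists_subset_of_mem_closure hAsat hy
    obtain ⟨V, hV, u, hu, hyu, huV⟩ := h𝒰 y
    obtain ⟨f, hfB, hyf, hfu⟩ := exists_iInter_closure_range_subset hB hyB u hu hyu
    have hPf := hP f ⟨V, u, hV, hu, hfu, huV⟩
    exact ⟨f, fun i l => hBA (hfB i l), hPf, fun i => hPf.2.2.1 i (hyf i)⟩
  let 𝒱 : Set (Set X) := {V | ∃ f : ι → ι → A, P (fun i l => f i l)
    (W fun i l => f i l) (h fun i l => f i l) ∧ W (fun i l => f i l) = V}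
  refine ⟨𝒱, ?_, ?_, eq_univ_of_forall fun x => ?_⟩
  · rintro V ⟨f, hf, rfl⟩
    exact hf.1
  · have hsub : 𝒱 ⊆ range fun f : ι → ι → A => W fun i l => (f i l : X) := by
      rintro V ⟨f, -, hf⟩
      exact ⟨f, hf⟩
    refine (mk_le_mk_of_subset hsub).trans (mk_range_le.trans ?_)
    rw [← power_def, ← power_def, ← power_mul, mul_eq_self hι]
    refine (power_le_power_right hA).trans ?_
    rw [← power_mul, mul_eq_self hι]
  by_contra hx
  have hsep : ∀ y : closure A, ∃ (f : ι → ι → X) (j : ι), (∀ i l, f i l ∈ A) ∧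
      IsOpen (h f j) ∧ (y : X) ∈ h f j ∧ x ∉ h f j := by
    intro y
    obtain ⟨f, hfA, hPf, hyf⟩ := hcover y y.2
    have hxW : x ∉ W f := fun hxW => hx ⟨W f, ⟨fun i l => ⟨f i l, hfA i l⟩, hPf, rfl⟩, hxW⟩
    obtain ⟨j, hj⟩ : ∃ j, x ∉ h f j := by
      by_contra! hcon
      exact hxW (hPf.2.2.2 (mem_iInter.2 hcon))
    exact ⟨f, j, hfA, hPf.2.1 j, hyf j, hj⟩
  choose f j hfA hfo hyf hxf using hsep
  obtain ⟨t, ht⟩ := isClosed_closure.isCompact.elim_finite_subcover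
    (fun y : closure A => h (f y) (j y)) hfo fun y hy => mem_iUnion.2 ⟨⟨y, hy⟩, hyf _⟩
  have htne : (t : Set (closure A)).Nonempty := by
    obtain ⟨y, hy, -⟩ := mem_iUnion₂.1 (ht (subset_closure (hA₀ rfl)))
    exact ⟨y, hy⟩
  obtain ⟨e, he⟩ := exists_range_eq_of_mk_le (ι := ι) htne
    ((t.finite_toSet.lt_aleph0).le.trans hι)
  have hmem := hAΦ (fun q => f (e q.1) q.2.1 q.2.2) (fun q => hfA _ _ _)
    (Or.inr ⟨fun k => j (e k), rfl⟩)
  refine hp (⋃ k, h (f (e k)) (j (e k))) x (by simpa using fun k => hxf (e k)) ?_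
  obtain ⟨y, hy, hyp⟩ := mem_iUnion₂.1 (ht (subset_closure hmem))
  obtain ⟨k, rfl⟩ : y ∈ range e := he ▸ hy
  exact mem_iUnion.2 ⟨k, hyp⟩

/-- For a compactum `X` and an infinite cardinal `κ`,
`L(X_κ) ≤ 2^{wt(X)·κ}`, where `X_κ` is `X` retopologized with the `G_κ`-sets as a base. -/
theorem lindelofDegree_GkappaModification_le
    (X : Type u) [TopologicalSpace X] [CompactSpace X] [T2Space X]
    (κ : Cardinal.{u}) (hκ : ℵ₀ ≤ κ) :
    @lindelofDegree X (TopologicalSpace.generateFrom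
      {G : Set X | ∃ 𝒰 : Set (Set X), #𝒰 ≤ κ ∧ (∀ U ∈ 𝒰, IsOpen U) ∧ G = ⋂₀ 𝒰}) ≤
      2 ^ (weakTightness X * κ) := by
  obtain ⟨hwt₀, 𝒞, h𝒞⟩ := exists_isWeakTightnessWitness X
  set μ := weakTightness X * κ
  have hκμ : κ ≤ μ := le_mul_left (aleph0_pos.trans_le hwt₀).ne'
  have hwtμ : weakTightness X ≤ μ := le_mul_right (aleph0_pos.trans_le hκ).ne'
  have hμ₀ : ℵ₀ ≤ μ := hκ.trans hκμ
  have hout : #μ.out = μ := mk_out μ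
  have : Infinite μ.out := infinite_iff.2 (hout.symm ▸ hμ₀)
  refine csInf_le' ⟨hμ₀.trans (cantor μ).le, fun 𝒰 h𝒰 hcov => ?_⟩
  have key := IsWeakTightnessWitness.exists_subcover (ι := μ.out)
    (hout.symm ▸ h𝒞.mono hwtμ) 𝒰 (by
      intro x
      obtain ⟨W, hW, hxW⟩ : x ∈ ⋃₀ 𝒰 := hcov ▸ mem_univ x
      obtain ⟨𝒢, h𝒢, h𝒢o, hx𝒢, h𝒢W⟩ := exists_Gκ_subset hκ (h𝒰 W hW) hxW
      obtain ⟨h, hh⟩ := exists_range_eq_of_mk_le (ι := μ.out) (insert_nonempty Set.univ 𝒢)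
        (hout.symm ▸ mk_insert_le.trans
          (add_le_of_le hμ₀ (h𝒢.trans hκμ) (one_le_aleph0.trans hμ₀)))
      have hmem : ∀ i, h i = Set.univ ∨ h i ∈ 𝒢 := fun i => by
        have : h i ∈ insert Set.univ 𝒢 := hh ▸ mem_range_self i
        exact this
      refine ⟨W, hW, h, fun i => ?_, fun i => ?_, ?_⟩
      · rcases hmem i with hi | hi
        · exact hi ▸ isOpen_univ
        · exact h𝒢o _ hi
      · rcases hmem i with hi | hi
        · exact hi ▸ mem_univ x
        · exact hx𝒢 _ hi
      · rw [← sInter_range, hh]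
        exact (sInter_subset_sInter (subset_insert _ _)).trans h𝒢W)
  rwa [hout] at key

end
end

section
/- If X is a homogeneous compactum, then d(X) ≤ 2^{wt(X)}. -/
open Cardinal Set Topology
universe u
noncomputable section

section CardinalArithmetic

theorem two_power_power_self {κ : Cardinal.{u}} (hκ : ℵ₀ ≤ κ) :
    ((2 : Cardinal.{u}) ^ κ) ^ κ = 2 ^ κ := by
  rw [← power_mul, mul_eq_self hκ]

theorem aleph0_le_two_power {κ : Cardinal.{u}} (hκ : ℵ₀ ≤ κ) : ℵ₀ ≤ (2 : Cardinal.{u}) ^ κ :=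
  hκ.trans (cantor κ).le

theorem mk_biUnion_le_of_forall_le {ι Y : Type u} {c : Cardinal.{u}} (hc : ℵ₀ ≤ c)
    {s : Set ι} {f : ι → Set Y} (hs : #s ≤ c) (hf : ∀ i ∈ s, #(f i) ≤ c) :
    #(⋃ i ∈ s, f i : Set Y) ≤ c := by
  have h : ⨆ i : s, #(f i.1) ≤ c := ciSup_le' fun i => hf i.1 i.2
  calc #(⋃ i ∈ s, f i : Set Y) ≤ #s * ⨆ i : s, #(f i.1) := mk_biUnion_le f s
    _ ≤ c * c := by gcongr
    _ = c := mul_eq_self hc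

theorem mk_union_le_of_le {Y : Type u} {c : Cardinal.{u}} (hc : ℵ₀ ≤ c) {s t : Set Y}
    (hs : #s ≤ c) (ht : #t ≤ c) : #(s ∪ t : Set Y) ≤ c :=
  (mk_union_le s t).trans (add_le_of_le hc hs ht)

/-- Closing off: if `F` assigns to each set of size at most `κ` a set of size at most `2 ^ κ`,
some set of size at most `2 ^ κ` is closed under `F`. -/
theorem exists_closed_under {Y : Type u} {κ : Cardinal.{u}} (hκ : ℵ₀ ≤ κ)
    (F : Set Y → Set Y) (hF : ∀ B : Set Y, #B ≤ κ → #(F B) ≤ 2 ^ κ) :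
    ∃ A : Set Y, #A ≤ 2 ^ κ ∧ ∀ B ⊆ A, #B ≤ κ → F B ⊆ A := by
  rcases isEmpty_or_nonempty Y with hY | hY
  · exact ⟨∅, by simp, fun B _ _ y => (hY.false y).elim⟩
  have key : ∀ B : Set Y, ∃ g : Set κ.out → Y, #B ≤ κ → F B ⊆ range g := by
    intro B
    by_cases hB : #B ≤ κ
    · rcases (F B).eq_empty_or_nonempty with h | h
      · exact ⟨fun _ => Classical.arbitrary Y, fun _ => by simp [h]⟩
      · have : Nonempty (F B) := h.to_subtype
        have hle : #(F B) ≤ #(Set κ.out) := by simpa using hF B hB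
        obtain ⟨e⟩ := hle
        refine ⟨fun s => (Function.invFun e s : F B), fun _ y hy => ⟨e ⟨y, hy⟩, ?_⟩⟩
        simp [Function.leftInverse_invFun e.injective _]
    · exact ⟨fun _ => Classical.arbitrary Y, fun h => (hB h).elim⟩
  choose g hg using key
  let W := WType (fun a : Set κ.out × Set κ.out => (a.1 : Type u))
  let value : W → Y := WType.elim Y (fun p => g (range p.2) p.1.2)
  have hW : #W ≤ 2 ^ κ := by
    apply WType.cardinalMk_le_of_le
    refine (sum_le_mk_mul_iSup _).trans ?_
    have h2 := aleph0_le_two_power hκ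
    have h3 : ⨆ a : Set κ.out × Set κ.out, ((2 : Cardinal.{u}) ^ κ) ^ #a.1 ≤ 2 ^ κ := by
      refine ciSup_le' fun a => ?_
      refine le_trans (power_le_power_left ?_ ?_) (two_power_power_self hκ).le
      · exact (aleph0_pos.trans_le h2).ne'
      · simpa using mk_set_le a.1
    have h4 : #(Set κ.out × Set κ.out) = 2 ^ κ := by simp [mul_eq_self h2]
    rw [h4]
    calc (2 : Cardinal.{u}) ^ κ * _ ≤ 2 ^ κ * 2 ^ κ := by gcongr
      _ = 2 ^ κ := mul_eq_self h2
  refine ⟨range value, mk_range_le.trans hW, fun B hBA hB y hy => ?_⟩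
  obtain ⟨s, hs⟩ := hg B hB hy
  have hle : #B ≤ #κ.out := by simpa using hB
  obtain ⟨e⟩ := hle
  choose w hw using fun b : B => hBA b.2
  let e' : B ≃ range e := Equiv.ofInjective e e.injective
  refine ⟨WType.mk (range e, s) (fun i => w (e'.symm i)), ?_⟩
  have : range (fun i : range e => value (w (e'.symm i))) = B := by
    ext z
    constructor
    · rintro ⟨i, rfl⟩
      simp [hw]
    · intro hz
      exact ⟨e' ⟨z, hz⟩, by simp [hw]⟩
  change g (range (fun i : range e => value (w (e'.symm i)))) s = y
  rw [this, hs]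

end CardinalArithmetic

section Saturated

variable {X : Type u} [TopologicalSpace X]

theorem exists_mem_closure_of_tightness_le {κ : Cardinal.{u}} (h : tightness X ≤ κ)
    {A : Set X} {y : X} (hy : y ∈ closure A) : ∃ B ⊆ A, #B ≤ κ ∧ y ∈ closure B := by
  have hne : {τ : Cardinal.{u} | ℵ₀ ≤ τ ∧ ∀ (A : Set X) (y : X), y ∈ closure A →
      ∃ B ⊆ A, #B ≤ τ ∧ y ∈ closure B}.Nonempty :=
    ⟨max ℵ₀ #X, le_max_left _ _, fun A y hy =>
      ⟨A, subset_rfl, (mk_set_le A).trans (le_max_right _ _), hy⟩⟩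
  obtain ⟨B, hBA, hB, hyB⟩ := (csInf_mem hne).2 A y hy
  exact ⟨B, hBA, hB.trans h, hyB⟩

/-- A set is saturated for `𝒞` if its trace on every member of `𝒞` is dense in it. -/
def IsSaturated (𝒞 : Set (Set X)) (A : Set X) : Prop :=
  ∀ C ∈ 𝒞, A ⊆ closure (A ∩ C)

theorem IsSaturated.iUnion {𝒞 : Set (Set X)} {ι : Type*} {A : ι → Set X}
    (h : ∀ i, IsSaturated 𝒞 (A i)) : IsSaturated 𝒞 (⋃ i, A i) := fun C hC =>
  iUnion_subset fun i => (h i C hC).trans <|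
    closure_mono <| inter_subset_inter_left C <| subset_iUnion A i

variable {κ : Cardinal.{u}} {𝒞 : Set (Set X)}

theorem IsSaturated.exists_mem_closure (hC : IsWeakTightnessWitness X κ 𝒞) {A : Set X}
    (hA : IsSaturated 𝒞 A) {x : X} (hx : x ∈ closure A) :
    ∃ B ⊆ A, #B ≤ κ ∧ x ∈ closure B := by
  obtain ⟨C, hC𝒞, hxC⟩ : x ∈ ⋃₀ 𝒞 := hC.1 ▸ mem_univ x
  have hx' : x ∈ closure (A ∩ C) := closure_minimal (hA C hC𝒞) isClosed_closure hx
  have hx'' : (⟨x, hxC⟩ : C) ∈ closure (Subtype.val ⁻¹' A : Set C) := by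
    rw [closure_subtype, Subtype.image_preimage_coe, inter_comm]
    exact hx'
  obtain ⟨B, hBA, hB, hxB⟩ := exists_mem_closure_of_tightness_le (hC.2.2 C hC𝒞).1 hx''
  exact ⟨Subtype.val '' B, image_subset_iff.2 hBA, mk_image_le.trans hB, closure_subtype.1 hxB⟩

theorem exists_saturating_map (hκ : ℵ₀ ≤ κ) (hC : IsWeakTightnessWitness X κ 𝒞) :
    ∃ S : X → Set X, (∀ x, #(S x) ≤ 2 ^ κ) ∧
      ∀ A : Set X, (∀ x ∈ A, S x ⊆ A) → IsSaturated 𝒞 A := by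
  have key : ∀ (x : X) (C : Set X), ∃ T : Set X,
      C ∈ 𝒞 → T ⊆ C ∧ #T ≤ 2 ^ κ ∧ x ∈ closure T := by
    intro x C
    by_cases h : C ∈ 𝒞
    · have hx : x ∈ kClosure (2 ^ κ) C := (hC.2.2 C h).2 ▸ mem_univ x
      simp only [kClosure, mem_iUnion] at hx
      obtain ⟨T, ⟨hTC, hT⟩, hxT⟩ := hx
      exact ⟨T, fun _ => ⟨hTC, hT, hxT⟩⟩
    · exact ⟨∅, fun h' => (h h').elim⟩
  choose T hT using key
  refine ⟨fun x => ⋃ C ∈ 𝒞, T x C, fun x => ?_, fun A hA C hC𝒞 x hx => ?_⟩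
  · exact mk_biUnion_le_of_forall_le (aleph0_le_two_power hκ) hC.2.1 fun C h => (hT x C h).2.1
  · refine closure_mono (subset_inter ?_ (hT x C hC𝒞).1) (hT x C hC𝒞).2.2
    exact (subset_biUnion_of_mem (u := fun C => T x C) hC𝒞).trans (hA x hx)

theorem exists_isSaturated_mem (hκ : ℵ₀ ≤ κ) (hC : IsWeakTightnessWitness X κ 𝒞) (x : X) :
    ∃ A : Set X, x ∈ A ∧ #A ≤ 2 ^ κ ∧ IsSaturated 𝒞 A := by
  obtain ⟨S, hS, hsat⟩ := exists_saturating_map hκ hC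
  have h2 := aleph0_le_two_power hκ
  obtain ⟨A, hA, hcl⟩ := exists_closed_under hκ (fun B => {x} ∪ ⋃ b ∈ B, S b) fun B hB =>
    mk_union_le_of_le h2 ((mk_singleton x).le.trans (one_le_aleph0.trans h2))
      (mk_biUnion_le_of_forall_le h2 (hB.trans (cantor κ).le) fun b _ => hS b)
  refine ⟨A, hcl ∅ (empty_subset A) (by simp) (by simp), hA, hsat A fun a ha => ?_⟩
  refine Subset.trans ?_ (hcl {a} (singleton_subset_iff.2 ha)
    ((mk_singleton a).le.trans (one_le_aleph0.trans hκ)))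
  simp

end Saturated

section GKappa

variable {X : Type u} [TopologicalSpace X]

/-- `G` is an intersection of at most `κ` open sets. -/
def IsGKappa (κ : Cardinal.{u}) (G : Set X) : Prop :=
  ∃ 𝒰 : Set (Set X), #𝒰 ≤ κ ∧ (∀ U ∈ 𝒰, IsOpen U) ∧ ⋂₀ 𝒰 = G

variable {κ : Cardinal.{u}}

theorem IsGKappa.iInter (hκ : ℵ₀ ≤ κ) {ι : Type u} (hι : #ι ≤ κ) {G : ι → Set X}
    (h : ∀ i, IsGKappa κ (G i)) : IsGKappa κ (⋂ i, G i) := by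
  choose 𝒰 h𝒰 hopen hG using h
  refine ⟨⋃ i, 𝒰 i, ?_, ?_, ?_⟩
  · simpa using mk_biUnion_le_of_forall_le hκ (s := univ) (by simpa using hι) fun i _ => h𝒰 i
  · simp only [mem_iUnion]
    rintro U ⟨i, hU⟩
    exact hopen i U hU
  · rw [sInter_iUnion]
    exact iInter_congr hG

theorem IsGKappa.inter (hκ : ℵ₀ ≤ κ) {G H : Set X} (hG : IsGKappa κ G) (hH : IsGKappa κ H) :
    IsGKappa κ (G ∩ H) := by
  obtain ⟨𝒰, h𝒰, hU, rfl⟩ := hG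
  obtain ⟨𝒱, h𝒱, hV, rfl⟩ := hH
  exact ⟨𝒰 ∪ 𝒱, mk_union_le_of_le hκ h𝒰 h𝒱, fun W hW => hW.elim (hU W) (hV W),
    sInter_union 𝒰 𝒱⟩

theorem IsGKappa.image {G : Set X} (hG : IsGKappa κ G) (e : X ≃ₜ X) : IsGKappa κ (e '' G) := by
  obtain ⟨𝒰, h𝒰, hU, rfl⟩ := hG
  refine ⟨Set.image e '' 𝒰, mk_image_le.trans h𝒰, ?_, ?_⟩
  · rintro _ ⟨U, hU', rfl⟩
    exact e.isOpenMap U (hU U hU')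
  · rw [sInter_image, sInter_eq_biInter, image_iInter₂ e.bijective]

theorem exists_isGKappa_disjoint [NormalSpace X] [T1Space X] (hκ : ℵ₀ ≤ κ) {F : Set X}
    (hF : IsClosed F) {z : X} (hz : z ∉ F) :
    ∃ Z : Set X, IsClosed Z ∧ IsGKappa κ Z ∧ z ∈ Z ∧ Disjoint Z F := by
  obtain ⟨f, hf0, hf1, -⟩ := exists_continuous_zero_one_of_isClosed (isClosed_singleton (x := z))
    hF (disjoint_singleton_left.2 hz)
  refine ⟨f ⁻¹' {0}, isClosed_singleton.preimage f.continuous,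
    ⟨range fun n : ULift.{u} ℕ => {x | |f x| < 1 / (n.down + 1 : ℝ)}, ?_, ?_, ?_⟩,
    hf0 rfl, ?_⟩
  · exact mk_range_le.trans (by simpa using hκ)
  · rintro _ ⟨n, rfl⟩
    exact isOpen_lt (by fun_prop) continuous_const
  · ext x
    simp only [sInter_range, mem_iInter, mem_ofPred_eq, mem_preimage, mem_singleton_iff]
    constructor
    · intro h
      by_contra hne
      obtain ⟨n, hn⟩ := exists_nat_one_div_lt (abs_pos.2 hne)
      exact (h ⟨n⟩).not_gt hn
    · intro h n
      rw [h, abs_zero]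
      positivity
  · rw [Set.disjoint_left]
    intro x hx hxF
    have h1 := hf1 hxF
    simp_all

/-- A family of closed intersections of `κ` open sets has few traces on the closure of a set of
size at most `κ`. -/
theorem exists_small_index_covering_closure [NormalSpace X] (hκ : ℵ₀ ≤ κ) {G : X → Set X}
    (hcl : ∀ x, IsClosed (G x)) (hG : ∀ x, IsGKappa κ (G x)) (hmem : ∀ x, x ∈ G x)
    {B : Set X} (hB : #B ≤ κ) :
    ∃ I : Set X, #I ≤ 2 ^ κ ∧ closure B ⊆ ⋃ x ∈ I, G x := by
  have htrace : ∀ x, ∃ 𝒱 : {𝒱 : Set (Set X) // 𝒱 ⊆ 𝒫 B ∧ #𝒱 ≤ κ},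
      closure B ∩ ⋂ V ∈ 𝒱.1, closure V = closure B ∩ G x := by
    intro x
    obtain ⟨𝒰, h𝒰, hU, hGx⟩ := hG x
    have hV : ∀ U : Set X, ∃ V : Set X, U ∈ 𝒰 → IsOpen V ∧ G x ⊆ V ∧ closure V ⊆ U := by
      intro U
      by_cases h : U ∈ 𝒰
      · obtain ⟨V, hV⟩ := normal_exists_closure_subset (hcl x) (hU U h)
          (hGx ▸ sInter_subset_of_mem h)
        exact ⟨V, fun _ => hV⟩
      · exact ⟨∅, fun h' => (h h').elim⟩
    choose V hV using hV
    refine ⟨⟨(fun U => V U ∩ B) '' 𝒰, ?_, mk_image_le.trans h𝒰⟩, ?_⟩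
    · rintro _ ⟨U, -, rfl⟩
      exact inter_subset_right
    · simp only [biInter_image]
      ext y
      simp only [mem_inter_iff, mem_iInter]
      refine and_congr_right fun hy => ⟨fun h => ?_, fun h U hU' => ?_⟩
      · rw [← hGx]
        exact fun U hU' => (hV U hU').2.2 (closure_mono inter_subset_left (h U hU'))
      · exact (hV U hU').1.inter_closure ⟨(hV U hU').2.1 h, hy⟩
  choose 𝒱 h𝒱 using htrace
  refine ⟨range fun t : range 𝒱 => t.2.choose, ?_, fun y hy => ?_⟩
  · refine mk_range_le.trans ((mk_set_le _).trans ((mk_bounded_subset_le _ _).trans ?_))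
    rw [mk_powerset]
    refine (Cardinal.power_le_power_right (c := κ) (max_le ?_ (aleph0_le_two_power hκ))).trans
      (two_power_power_self hκ).le
    exact power_le_power_left two_ne_zero hB
  · have ht : 𝒱 (mem_range_self (f := 𝒱) y).choose = 𝒱 y := (mem_range_self (f := 𝒱) y).choose_spec
    simp only [mem_iUnion]
    refine ⟨_, ⟨⟨𝒱 y, mem_range_self y⟩, rfl⟩, ?_⟩
    have h1 : y ∈ closure B ∩ G y := ⟨hy, hmem y⟩
    rw [← h𝒱 y, ← ht, h𝒱] at h1
    exact h1.2

end GKappa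

section Compact

variable {X : Type u} [TopologicalSpace X] [CompactSpace X] [T2Space X]
  {κ : Cardinal.{u}} {𝒞 : Set (Set X)}

/-- A cover of a compactum by closed intersections of `κ` open sets has a subcover of size at most
`2 ^ κ`. -/
theorem exists_small_subcover (hκ : ℵ₀ ≤ κ) (hC : IsWeakTightnessWitness X κ 𝒞) {G : X → Set X}
    (hcl : ∀ x, IsClosed (G x)) (hG : ∀ x, IsGKappa κ (G x)) (hmem : ∀ x, x ∈ G x) :
    ∃ A : Set X, #A ≤ 2 ^ κ ∧ ⋃ x ∈ A, G x = Set.univ := by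
  rcases isEmpty_or_nonempty X with hX | hX
  · exact ⟨∅, by simp, Subsingleton.elim _ _⟩
  have h2 := aleph0_le_two_power hκ
  have hκ2 : κ ≤ 2 ^ κ := (cantor κ).le
  obtain ⟨S, hS, hsat⟩ := exists_saturating_map hκ hC
  have hI : ∀ B : Set X, ∃ I : Set X, #B ≤ κ → #I ≤ 2 ^ κ ∧ closure B ⊆ ⋃ x ∈ I, G x := by
    intro B
    by_cases h : #B ≤ κ
    · obtain ⟨I, hI⟩ := exists_small_index_covering_closure hκ hcl hG hmem h
      exact ⟨I, fun _ => hI⟩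
    · exact ⟨∅, fun h' => (h h').elim⟩
  choose I hI using hI
  choose 𝒰 h𝒰 hopen hGU using hG
  have hpt : ∀ 𝒱 : Set (Set X), ∃ p : X, ⋃₀ 𝒱 ≠ Set.univ → p ∉ ⋃₀ 𝒱 := by
    intro 𝒱
    by_cases h : ⋃₀ 𝒱 = Set.univ
    · exact ⟨Classical.arbitrary X, fun h' => (h' h).elim⟩
    · obtain ⟨p, hp⟩ := (ne_univ_iff_exists_notMem _).1 h
      exact ⟨p, fun _ => hp⟩
  choose pt hpt using hpt
  obtain ⟨A, hA, hclosed⟩ := exists_closed_under hκ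
    (fun B => (I B ∪ ⋃ b ∈ B, S b) ∪ pt '' 𝒫 (⋃ b ∈ B, 𝒰 b)) fun B hB => by
      refine mk_union_le_of_le h2 (mk_union_le_of_le h2 (hI B hB).1 ?_) (mk_image_le.trans ?_)
      · exact mk_biUnion_le_of_forall_le h2 (hB.trans hκ2) fun b _ => hS b
      · rw [mk_powerset]
        exact power_le_power_left two_ne_zero
          (mk_biUnion_le_of_forall_le hκ hB fun b _ => h𝒰 b)
  have hAsat : IsSaturated 𝒞 A := hsat A fun a ha => by
    refine Subset.trans ?_ (hclosed {a} (singleton_subset_iff.2 ha)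
      ((mk_singleton a).le.trans (one_le_aleph0.trans hκ)))
    intro y hy
    exact Or.inl (Or.inr (by simpa using hy))
  have hcov : closure A ⊆ ⋃ x ∈ A, G x := by
    intro y hy
    obtain ⟨B, hBA, hB, hyB⟩ := hAsat.exists_mem_closure hC hy
    refine biUnion_mono (fun x hx => ?_) (fun _ _ => subset_rfl) ((hI B hB).2 hyB)
    exact hclosed B hBA hB (Or.inl (Or.inl hx))
  refine ⟨A, hA, ?_⟩
  by_contra hne
  obtain ⟨p, hp⟩ := (ne_univ_iff_exists_notMem _).1 hne
  have hV : ∀ a : A, ∃ V ∈ 𝒰 a, p ∉ V := by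
    intro a
    have hpa : p ∉ G a := fun h => hp (mem_biUnion a.2 h)
    rw [← hGU a] at hpa
    simpa [mem_sInter] using hpa
  choose V hV𝒰 hpV using hV
  have hAV : closure A ⊆ ⋃ a : A, V a := by
    intro y hy
    obtain ⟨a, ha, hya⟩ := mem_iUnion₂.1 (hcov hy)
    rw [← hGU a] at hya
    exact mem_iUnion.2 ⟨⟨a, ha⟩, hya _ (hV𝒰 ⟨a, ha⟩)⟩
  obtain ⟨t, ht⟩ := isClosed_closure.isCompact.elim_finite_subcover V
    (fun a => hopen a _ (hV𝒰 a)) hAV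
  have hpt' : pt (V '' t) ∉ ⋃₀ (V '' t) := by
    refine hpt _ fun h => ?_
    obtain ⟨_, ⟨a, -, rfl⟩, hpa⟩ := h ▸ mem_univ p
    exact hpV a hpa
  have hmemA : pt (V '' t) ∈ A := by
    refine hclosed (Subtype.val '' (t : Set A)) (by simp) ?_ (Or.inr ⟨_, ?_, rfl⟩)
    · exact ((t.finite_toSet.image _).lt_aleph0.le).trans hκ
    · rintro _ ⟨a, ha, rfl⟩
      exact mem_biUnion (mem_image_of_mem _ ha) (hV𝒰 a)
  refine hpt' ?_
  rw [sUnion_image]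
  exact ht (subset_closure hmemA)

/-- A closed nonempty intersection of `κ` open sets which is not contained in the closure of `H`
shrinks to one that misses the closure of `H`. -/
theorem exists_isGKappa_subset_disjoint (hκ : ℵ₀ ≤ κ) {K H : Set X} (hK : IsClosed K)
    (hKG : IsGKappa κ K) (hKH : ¬ K ⊆ closure H) :
    ∃ K' ⊆ K, IsClosed K' ∧ IsGKappa κ K' ∧ K'.Nonempty ∧ Disjoint K' (closure H) := by
  obtain ⟨z, hzK, hz⟩ := not_subset.1 hKH
  obtain ⟨Z, hZ, hZG, hzZ, hdisj⟩ := exists_isGKappa_disjoint hκ isClosed_closure hz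
  exact ⟨K ∩ Z, inter_subset_left, hK.inter hZ, hKG.inter hκ hZG, ⟨z, hzK, hzZ⟩,
    hdisj.mono_left inter_subset_right⟩

theorem exists_isGKappa_subset_closure [Nonempty X] (hκ : ℵ₀ ≤ κ)
    (hC : IsWeakTightnessWitness X κ 𝒞) :
    ∃ G H : Set X, IsClosed G ∧ IsGKappa κ G ∧ G.Nonempty ∧ #H ≤ 2 ^ κ ∧ G ⊆ closure H := by
  by_contra! hno
  have hshrink : ∀ K H : Set X, ∃ K' : Set X,
      IsClosed K → IsGKappa κ K → K.Nonempty → #H ≤ 2 ^ κ →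
        K' ⊆ K ∧ IsClosed K' ∧ IsGKappa κ K' ∧ K'.Nonempty ∧ Disjoint K' (closure H) := by
    intro K H
    by_cases h : IsClosed K ∧ IsGKappa κ K ∧ K.Nonempty ∧ #H ≤ 2 ^ κ
    · obtain ⟨K', hK'⟩ := exists_isGKappa_subset_disjoint hκ h.1 h.2.1
        (hno K H h.1 h.2.1 h.2.2.1 h.2.2.2)
      exact ⟨K', fun _ _ _ _ => hK'⟩
    · exact ⟨∅, fun h1 h2 h3 h4 => (h ⟨h1, h2, h3, h4⟩).elim⟩
  choose Φ hΦ using hshrink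
  choose A hxA hA hAsat using exists_isSaturated_mem hκ hC
  have hpt : ∀ K : Set X, ∃ p : X, K.Nonempty → p ∈ K := fun K => by
    by_cases h : K.Nonempty
    · exact ⟨h.some, fun _ => h.some_mem⟩
    · exact ⟨Classical.arbitrary X, fun h' => (h h').elim⟩
  choose pt hpt using hpt
  let ι := (Order.succ κ).ord.ToType
  let step : (α : ι) → ((β : ι) → β < α → Set X) → Set X := fun α ih =>
    Φ (⋂ β : Iio α, ih β.1 β.2) (⋃ β : Iio α, A (pt (ih β.1 β.2)))
  let K : ι → Set X := wellFounded_lt.fix step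
  have hKeq : ∀ α, K α = Φ (⋂ β : Iio α, K β) (⋃ β : Iio α, A (pt (K β))) :=
    fun α => wellFounded_lt.fix_eq step α
  have hIio : ∀ α : ι, #(Iio α) ≤ κ := fun α => by
    simpa [ι] using mk_Iio_lt α (by simp [ι])
  have hK : ∀ α, K α ⊆ ⋂ β : Iio α, K β ∧ IsClosed (K α) ∧ IsGKappa κ (K α) ∧ (K α).Nonempty ∧
      Disjoint (K α) (closure (⋃ β : Iio α, A (pt (K β)))) := by
    intro α
    induction α using WellFoundedLT.induction with
    | ind α ih =>
      rw [hKeq α]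
      refine hΦ _ _ (isClosed_iInter fun β => (ih β.1 β.2).2.1)
        (IsGKappa.iInter hκ (hIio α) fun β => (ih β.1 β.2).2.2.1) ?_ ?_
      · rcases isEmpty_or_nonempty (Iio α) with h | h
        · simp
        · refine IsCompact.nonempty_iInter_of_directed_nonempty_isCompact_isClosed _ ?_
            (fun β => (ih β.1 β.2).2.2.2.1) (fun β => (ih β.1 β.2).2.1.isCompact)
            (fun β => (ih β.1 β.2).2.1)
          refine directed_of_isDirected_le fun β γ hβγ => ?_
          rcases hβγ.eq_or_lt with rfl | hlt
          · exact subset_rfl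
          · exact (ih γ.1 γ.2).1.trans (iInter_subset (fun δ : Iio γ.1 => K δ) ⟨β.1, hlt⟩)
      · simpa using mk_biUnion_le_of_forall_le (aleph0_le_two_power hκ) (s := Set.univ)
          (f := fun β : Iio α => A (pt (K β)))
          (by simpa using (hIio α).trans (cantor κ).le) fun β _ => hA _
  have hanti : ∀ β γ : ι, β ≤ γ → K γ ⊆ K β := fun β γ hβγ => by
    rcases hβγ.eq_or_lt with rfl | hlt
    · exact subset_rfl
    · exact (hK γ).1.trans (iInter_subset (fun δ : Iio γ => K δ) ⟨β, hlt⟩)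
  let H : Set X := ⋃ α : ι, A (pt (K α))
  have hHsat : IsSaturated 𝒞 H := IsSaturated.iUnion fun α => hAsat _
  have : Nonempty ι := by
    rw [← mk_ne_zero_iff, mk_ord_toType]
    exact (Order.bot_lt_succ κ).ne'
  obtain ⟨p, hp⟩ : (⋂ α, K α ∩ closure H).Nonempty := by
    refine IsCompact.nonempty_iInter_of_directed_nonempty_isCompact_isClosed _
      (directed_of_isDirected_le fun β γ hβγ => inter_subset_inter_left _ (hanti β γ hβγ))
      (fun α => ⟨pt (K α), hpt _ (hK α).2.2.2.1, subset_closure ?_⟩)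
      (fun α => ((hK α).2.1.inter isClosed_closure).isCompact)
      (fun α => (hK α).2.1.inter isClosed_closure)
    exact mem_iUnion.2 ⟨α, hxA _⟩
  rw [mem_iInter] at hp
  obtain ⟨B, hBH, hB, hpB⟩ := hHsat.exists_mem_closure hC (hp (Classical.arbitrary ι)).2
  choose a ha using fun b : B => mem_iUnion.1 (hBH b.2)
  have hbdd : ¬ IsCofinal (range a) := fun h => by
    have h1 : Order.succ κ ≤ #(range a) := by
      have h0 := Order.cof_le h
      rwa [Ordinal.cof_toType, (isRegular_succ hκ).cof_ord] at h0
    exact (Order.lt_succ κ).not_ge (h1.trans (mk_range_le.trans hB))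
  obtain ⟨γ, hγ⟩ := not_isCofinal_iff.1 hbdd
  refine (hK γ).2.2.2.2.notMem_of_mem_left (hp γ).1 (closure_mono ?_ hpB)
  exact fun b hb => mem_iUnion.2 ⟨⟨a ⟨b, hb⟩, hγ _ (mem_range_self _)⟩, ha ⟨b, hb⟩⟩

end Compact

/-- If `X` is a homogeneous compactum then `d(X) ≤ 2^{wt(X)}`. -/
theorem density_le_of_homogeneous_compactum
    (X : Type u) [TopologicalSpace X] [CompactSpace X] [T2Space X]
    (hhom : ∀ x y : X, ∃ h : X ≃ₜ X, h x = y) :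
    density X ≤ 2 ^ weakTightness X := by
  obtain ⟨hκ, 𝒞, hC⟩ := exists_isWeakTightnessWitness X
  have h2 := aleph0_le_two_power hκ
  rcases isEmpty_or_nonempty X with hX | hX
  · exact csInf_le' ⟨h2, ∅, fun x => (hX.false x).elim, by simp⟩
  obtain ⟨G, H, hG, hGκ, ⟨g, hg⟩, hH, hGH⟩ := exists_isGKappa_subset_closure hκ hC
  choose e he using fun x => hhom g x
  obtain ⟨A, hA, hcov⟩ := exists_small_subcover hκ hC (G := fun x => e x '' G)
    (fun x => (e x).isClosed_image.2 hG) (fun x => hGκ.image (e x)) (fun x => ⟨g, hg, he x⟩)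
  refine csInf_le' ⟨h2, ⋃ x ∈ A, e x '' H, fun y => ?_,
    mk_biUnion_le_of_forall_le h2 hA fun x _ => mk_image_le.trans hH⟩
  obtain ⟨x, hx, hy⟩ := mem_iUnion₂.1 (hcov ▸ mem_univ y)
  refine closure_mono (subset_biUnion_of_mem (u := fun x => e x '' H) hx) ?_
  rw [← (e x).image_closure]
  exact image_mono hGH hy

end
end
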